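/- For any i ≥ 0, j ≥ 0: the word u = (ba)^i (bb)(ab)^j(ba)^j b rewrites (using ab→ba and moving b's over a's, and moving letters cyclically via the ⇒ relation) to b(ab)^j(ba)^j a^{?}... Specifically, following Case 1(a) with p = (ab)^j(ba)^j: u ⇒* b · a^{i+2} · p · b and b · p · a^{i+2} · b is its reversal; hence u·ū satisfies the crossing condition. -/

import Mathlib

/-- The four-letter alphabet `{a, b, ā, b̄}`; `A` stands for `ā` and `B` for `b̄`. -/
inductive L : Type
  | a | b | A | B
deriving DecidableEq

/-- The antiparallel letter: `a ↔ ā`, `b ↔ b̄`. -/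
def bar : L → L
  | .a => .A
  | .A => .a
  | .b => .B
  | .B => .b

/-- Letterwise application of the involution `a ↔ ā`, `b ↔ b̄` to a word. -/
def barw (w : List L) : List L := w.map bar

/-- The eight rewrite rules of the Sub Rosa system:
`ab→ba`, `bā→āb`, `āb̄→b̄ā`, `b̄a→ab̄`, `aā→ε`, `āa→ε`, `bb̄→ε`, `b̄b→ε`. -/
def Rule : List L → List L → Prop := fun x y =>
  (x = [.a, .b] ∧ y = [.b, .a]) ∨ (x = [.b, .A] ∧ y = [.A, .b]) ∨
  (x = [.A, .B] ∧ y = [.B, .A]) ∨ (x = [.B, .a] ∧ y = [.a, .B]) ∨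
  (x = [.a, .A] ∧ y = []) ∨ (x = [.A, .a] ∧ y = []) ∨
  (x = [.b, .B] ∧ y = []) ∨ (x = [.B, .b] ∧ y = [])

/-- One rewrite step: replace a factor matching the left side of a rule by its right side. -/
def Step (u v : List L) : Prop :=
  ∃ p s x y, Rule x y ∧ u = p ++ x ++ s ∧ v = p ++ y ++ s

/-- `u →* v`: the reflexive transitive closure of the rewrite step. -/
def Steps : List L → List L → Prop := Relation.ReflTransGen Step

/-- `rep w n` is the `n`-fold concatenation `w^n`. -/
def rep (w : List L) (n : ℕ) : List L := (List.replicate n w).flatten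

/-- A matching on a word pairs each occurrence of a letter with an occurrence of its
antiparallel letter, bijectively (an involution without fixed points). -/
structure Matching (w : List L) where
  m : Fin w.length → Fin w.length
  invol : ∀ i, m (m i) = i
  nofix : ∀ i, m i ≠ i
  compat : ∀ i, w.get (m i) = bar (w.get i)

/-- The 4-tuples of letters that are cyclic rotations of `(a, b, ā, b̄)`. -/
def Rot4 : L → L → L → L → Prop := fun x y z t =>
  (x = .a ∧ y = .b ∧ z = .A ∧ t = .B) ∨ (x = .b ∧ y = .A ∧ z = .B ∧ t = .a) ∨
  (x = .A ∧ y = .B ∧ z = .a ∧ t = .b) ∨ (x = .B ∧ y = .a ∧ z = .b ∧ t = .A)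

/-- The crossing condition: whenever two matched pairs interleave (cross) in the cyclic
word, the four letters read in positional order form a cyclic rotation of `a, b, ā, b̄`. -/
def CrossOK {w : List L} (M : Matching w) : Prop :=
  ∀ i j i' j' : Fin w.length, i < j → j < i' → i' < j' →
    M.m i = i' → M.m j = j' →
    Rot4 (w.get i) (w.get j) (w.get i') (w.get j')

/-- A word admits a matching satisfying the crossing condition. -/
def GoodWord (w : List L) : Prop := ∃ M : Matching w, CrossOK M

/-- `u ⇒ v`: either a rewrite step, or the conjugation-with-flip `xy ⤳ y x̄`
(move a prefix to the end with all letters replaced by their antiparallels). -/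
def FStep (u v : List L) : Prop :=
  Step u v ∨ ∃ x y, u = x ++ y ∧ v = y ++ barw x

/-- `u ⇒* v`: the reflexive transitive closure of `⇒`. -/
def FSteps : List L → List L → Prop := Relation.ReflTransGen FStep

/-- A matching satisfying the crossing condition, as a function on natural-number positions. -/
structure IsGoodMatching (w : List L) (f : ℕ → ℕ) : Prop where
  lt : ∀ i, i < w.length → f i < w.length
  invol : ∀ i, i < w.length → f (f i) = i
  nofix : ∀ i, i < w.length → f i ≠ i
  compat : ∀ i, i < w.length → w[f i]? = w[i]?.map bar
  cross : ∀ i j x y, i < j → j < f i → f i < f j → w[i]? = some x → w[j]? = some y →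
    Rot4 x y (bar x) (bar y)

theorem IsGoodMatching.goodWord {w : List L} {f : ℕ → ℕ} (h : IsGoodMatching w f) :
    GoodWord w := by
  have hc (i : Fin w.length) : w.get ⟨f i, h.lt i i.2⟩ = bar (w.get i) := by
    have := h.compat i i.2
    rw [List.getElem?_eq_getElem (h.lt i i.2), List.getElem?_eq_getElem i.2] at this
    simpa using this
  refine ⟨⟨fun i => ⟨f i, h.lt i i.2⟩, fun i => Fin.ext (h.invol i i.2),
    fun i hi => h.nofix i i.2 (congrArg Fin.val hi), hc⟩, ?_⟩
  rintro i j _ _ hij hji hlt rfl rfl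
  rw [hc, hc]
  exact h.cross i j _ _ hij hji hlt (List.getElem?_eq_getElem i.2) (List.getElem?_eq_getElem j.2)

theorem bar_bar (x : L) : bar (bar x) = x := by
  cases x <;> rfl

theorem Rot4.rotate {x y z t : L} (h : Rot4 x y z t) : Rot4 t x y z := by
  unfold Rot4 at *
  tauto

/-- Exchanging adjacent letters `x`, `y` with `(x, y, x̄, ȳ)` a rotation of `(a, b, ā, b̄)`
pulls good matchings back. -/
theorem IsGoodMatching.swap {p s : List L} {x y : L} {f : ℕ → ℕ}
    (hr : Rot4 x y (bar x) (bar y)) (h : IsGoodMatching (p ++ [y, x] ++ s) f) :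
    ∃ g, IsGoodMatching (p ++ [x, y] ++ s) g := by
  obtain ⟨σ, hσ⟩ : ∃ σ : ℕ → ℕ, ∀ k, σ k =
      if k = p.length then p.length + 1 else if k = p.length + 1 then p.length else k :=
    ⟨_, fun _ => rfl⟩
  have hσσ (k) : σ (σ k) = k := by grind
  have hmono (k l) (hkl : k < l) (hne : ¬(k = p.length ∧ l = p.length + 1)) : σ k < σ l := by
    grind
  have hlen : (p ++ [y, x] ++ s).length = (p ++ [x, y] ++ s).length := by simp
  have hσlt (k) (hk : k < (p ++ [x, y] ++ s).length) : σ k < (p ++ [x, y] ++ s).length := by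
    simp at hk ⊢
    grind
  have hget (k) : (p ++ [y, x] ++ s)[σ k]? = (p ++ [x, y] ++ s)[k]? := by
    grind
  have hget' (k) : (p ++ [x, y] ++ s)[σ k]? = (p ++ [y, x] ++ s)[k]? := by
    rw [← hget, hσσ]
  have hx : (p ++ [x, y] ++ s)[p.length]? = some x := by simp
  have hy : (p ++ [x, y] ++ s)[p.length + 1]? = some y := by simp
  generalize p ++ [y, x] ++ s = v at *
  generalize p ++ [x, y] ++ s = w at *
  have hlt (k) (hk : k < w.length) : σ (f (σ k)) < w.length :=
    hσlt _ (hlen ▸ h.lt _ (hlen ▸ hσlt k hk))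
  have hcompat (k) (hk : k < w.length) : w[σ (f (σ k))]? = w[k]?.map bar := by
    rw [hget', h.compat _ (hlen ▸ hσlt k hk), hget]
  refine ⟨fun k => σ (f (σ k)), hlt, fun k hk => ?_, fun k hk he => ?_, hcompat, ?_⟩
  · simp only [hσσ]
    rw [h.invol _ (hlen ▸ hσlt k hk), hσσ]
  · exact h.nofix _ (hlen ▸ hσlt k hk) (by rw [← hσσ (f (σ k)), he])
  · intro i j c d hij hji hlt' hc hd
    have hi : i < w.length := (List.getElem?_eq_some_iff.1 hc).1
    have hj : j < w.length := (List.getElem?_eq_some_iff.1 hd).1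
    have hci := hcompat i hi
    have hdj := hcompat j hj
    rw [hc] at hci
    rw [hd] at hdj
    simp only [Option.map_some] at hci hdj
    by_cases h1 : i = p.length ∧ j = p.length + 1
    · obtain ⟨rfl, rfl⟩ := h1
      grind
    by_cases h2 : j = p.length ∧ σ (f (σ i)) = p.length + 1
    · obtain ⟨rfl, h2⟩ := h2
      obtain rfl : d = x := by grind
      obtain rfl : y = bar c := by grind
      simpa only [bar_bar] using hr.rotate
    by_cases h3 : σ (f (σ i)) = p.length ∧ σ (f (σ j)) = p.length + 1
    · obtain rfl : x = bar c := by grind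
      obtain rfl : y = bar d := by grind
      simpa only [bar_bar] using hr.rotate.rotate
    refine h.cross (σ i) (σ j) c d (hmono _ _ hij h1) ?_ ?_ (by rw [hget, hc]) (by rw [hget, hd])
    · simpa only [hσσ] using hmono _ _ hji h2
    · simpa only [hσσ] using hmono _ _ hlt' h3

/-- Good matchings extend over the insertion of two adjacent antiparallel letters. -/
theorem IsGoodMatching.insert {p s : List L} (x : L) {f : ℕ → ℕ}
    (h : IsGoodMatching (p ++ s) f) :
    ∃ g, IsGoodMatching (p ++ [x, bar x] ++ s) g := by
  obtain ⟨σ, hσ⟩ : ∃ σ : ℕ → ℕ, ∀ k, σ k = if k < p.length then k else k + 2 :=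
    ⟨_, fun _ => rfl⟩
  obtain ⟨τ, hτ⟩ : ∃ τ : ℕ → ℕ, ∀ k, τ k = if k < p.length then k else k - 2 :=
    ⟨_, fun _ => rfl⟩
  obtain ⟨g, hg⟩ : ∃ g : ℕ → ℕ, ∀ k, g k = if k = p.length then p.length + 1 else
      if k = p.length + 1 then p.length else σ (f (τ k)) := ⟨_, fun _ => rfl⟩
  have hτσ (k) : τ (σ k) = k := by grind
  have hστ (k) (h1 : k ≠ p.length) (h2 : k ≠ p.length + 1) : σ (τ k) = k := by grind
  have hσne (k) : σ k ≠ p.length ∧ σ k ≠ p.length + 1 := by grind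
  have hlen : (p ++ [x, bar x] ++ s).length = (p ++ s).length + 2 := by simp; omega
  have hple : p.length ≤ (p ++ s).length := by simp
  have hget (k) : (p ++ [x, bar x] ++ s)[σ k]? = (p ++ s)[k]? := by
    rw [hσ]
    split_ifs with hk
    · simp [List.getElem?_append_left hk]
    · obtain ⟨m, rfl⟩ := Nat.exists_eq_add_of_le (not_lt.1 hk)
      simp [List.getElem?_append_right, add_assoc]
  have hx : (p ++ [x, bar x] ++ s)[p.length]? = some x := by simp
  have hy : (p ++ [x, bar x] ++ s)[p.length + 1]? = some (bar x) := by simp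
  generalize p ++ s = v at *
  generalize p ++ [x, bar x] ++ s = w at *
  have hσlt (k) (hk : k < v.length) : σ k < w.length := by grind
  have hτlt (k) (hk : k < w.length) (h1 : k ≠ p.length) (h2 : k ≠ p.length + 1) :
      τ k < v.length := by grind
  refine ⟨g, fun k hk => ?_, fun k hk => ?_, fun k hk => ?_, fun k hk => ?_, ?_⟩
  · have := h.lt (τ k)
    grind
  · have := h.invol (τ k)
    grind
  · have := h.nofix (τ k)
    grind
  · by_cases h1 : k = p.length
    · grind
    by_cases h2 : k = p.length + 1
    · grind [bar_bar]
    rw [hg, if_neg h1, if_neg h2, hget, h.compat _ (hτlt k hk h1 h2), ← hget, hστ k h1 h2]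
  · intro i j c d hij hji hlt hc hd
    have hi1 : i ≠ p.length := by grind
    have hi2 : i ≠ p.length + 1 := by grind
    have hj1 : j ≠ p.length := by grind
    have hj2 : j ≠ p.length + 1 := by grind
    rw [hg i, if_neg hi1, if_neg hi2] at hji hlt
    rw [hg j, if_neg hj1, if_neg hj2] at hlt
    refine h.cross (τ i) (τ j) c d ?_ ?_ ?_ (by rw [← hget, hστ i hi1 hi2, hc])
      (by rw [← hget, hστ j hj1 hj2, hd])
    · grind
    · grind
    · grind

theorem Step.exists_isGoodMatching {u v : List L} (h : Step u v)
    (hv : ∃ f, IsGoodMatching v f) : ∃ f, IsGoodMatching u f := by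
  obtain ⟨p, s, x, y, hr, rfl, rfl⟩ := h
  obtain ⟨f, hf⟩ := hv
  rcases hr with ⟨rfl, rfl⟩ | ⟨rfl, rfl⟩ | ⟨rfl, rfl⟩ | ⟨rfl, rfl⟩ | ⟨rfl, rfl⟩ | ⟨rfl, rfl⟩ |
    ⟨rfl, rfl⟩ | ⟨rfl, rfl⟩
  iterate 4 exact hf.swap (by simp [Rot4, bar])
  all_goals
    rw [List.append_nil] at hf
    exact hf.insert _

/-- A word that rewrites to the empty word has a matching satisfying the crossing condition. -/
theorem Steps.goodWord {w : List L} (h : Steps w []) : GoodWord w := by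
  suffices ∃ f, IsGoodMatching w f from this.elim fun _ hf => hf.goodWord
  induction h using Relation.ReflTransGen.head_induction_on with
  | refl => exact ⟨id, by simp, by simp, by simp, by simp, by simp⟩
  | head hs _ ih => exact hs.exists_isGoodMatching ih

theorem Steps.refl (u : List L) : Steps u u :=
  Relation.ReflTransGen.refl

theorem Steps.trans {u v w : List L} (huv : Steps u v) (hvw : Steps v w) : Steps u w :=
  Relation.ReflTransGen.trans huv hvw

theorem Step.steps {u v : List L} (h : Step u v) : Steps u v :=
  Relation.ReflTransGen.single h

theorem Steps.append_left {u v : List L} (l : List L) (h : Steps u v) :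
    Steps (l ++ u) (l ++ v) := by
  refine Relation.ReflTransGen.lift (l ++ ·) ?_ _ _ h
  rintro _ _ ⟨p, s, x, y, hr, rfl, rfl⟩
  exact ⟨l ++ p, s, x, y, hr, by simp, by simp⟩

theorem Steps.append_right {u v : List L} (r : List L) (h : Steps u v) :
    Steps (u ++ r) (v ++ r) := by
  refine Relation.ReflTransGen.lift (· ++ r) ?_ _ _ h
  rintro _ _ ⟨p, s, x, y, hr, rfl, rfl⟩
  exact ⟨p, s ++ r, x, y, hr, by simp, by simp⟩

theorem Rule.barw {x y : List L} (h : Rule x y) : Rule (barw x) (barw y) := by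
  rcases h with ⟨rfl, rfl⟩ | ⟨rfl, rfl⟩ | ⟨rfl, rfl⟩ | ⟨rfl, rfl⟩ | ⟨rfl, rfl⟩ | ⟨rfl, rfl⟩ |
    ⟨rfl, rfl⟩ | ⟨rfl, rfl⟩ <;> simp [Rule, _root_.barw, bar]

theorem Steps.barw {u v : List L} (h : Steps u v) : Steps (barw u) (barw v) := by
  refine Relation.ReflTransGen.lift _root_.barw ?_ _ _ h
  rintro _ _ ⟨p, s, x, y, hr, rfl, rfl⟩
  exact ⟨_root_.barw p, _root_.barw s, _, _, hr.barw, by simp [_root_.barw],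
    by simp [_root_.barw]⟩

theorem Steps.fSteps {u v : List L} (h : Steps u v) : FSteps u v :=
  Relation.ReflTransGen.mono (fun _ _ => Or.inl) _ _ h

theorem steps_reverse_append_barw (v : List L) : Steps (v.reverse ++ barw v) [] := by
  induction v with
  | nil => exact .refl _
  | cons x v ih =>
    refine (Step.steps ⟨v.reverse, barw v, [x, bar x], [], ?_, by simp [barw], rfl⟩).trans
      (by simpa using ih)
    cases x <;> simp [Rule, bar]

/-- If `u` rewrites to a word that rewrites to its own reversal, then `uū` is good. -/
theorem goodWord_append_barw {u v : List L} (huv : Steps u v) (hv : Steps v v.reverse) :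
    GoodWord (u ++ barw u) :=
  Steps.goodWord <| ((huv.trans hv).append_right _).trans <|
    (huv.barw.append_left _).trans (steps_reverse_append_barw v)

theorem rep_singleton (x : L) (n : ℕ) : rep [x] n = List.replicate n x := by
  simp [rep]

theorem reverse_rep (w : List L) (n : ℕ) : (rep w n).reverse = rep w.reverse n := by
  simp [rep, List.reverse_flatten]

theorem mem_of_mem_rep {w : List L} {n : ℕ} {x : L} (h : x ∈ rep w n) : x ∈ w := by
  obtain ⟨l, hl, hx⟩ := List.mem_flatten.1 h
  exact List.eq_of_mem_replicate hl ▸ hx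

theorem steps_replicate_a_b (n : ℕ) :
    Steps (List.replicate n L.a ++ [L.b]) ([L.b] ++ List.replicate n L.a) := by
  induction n with
  | zero => exact .refl _
  | succ n ih =>
    refine (ih.append_left [L.a]).trans (Step.steps ⟨[], List.replicate n L.a, [L.a, L.b], _,
      Or.inl ⟨rfl, rfl⟩, by simp, by simp [List.replicate_succ]⟩)

/-- A power of `a` moves past every word over `{a, b}`. -/
theorem steps_replicate_a_append (n : ℕ) (p : List L) (hp : ∀ x ∈ p, x = L.a ∨ x = L.b) :
    Steps (List.replicate n L.a ++ p) (p ++ List.replicate n L.a) := by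
  induction p with
  | nil => simpa using Steps.refl _
  | cons x p ih =>
    have hx : Steps (List.replicate n L.a ++ [x]) ([x] ++ List.replicate n L.a) := by
      rcases hp x (by simp) with rfl | rfl
      · rw [← List.replicate_succ', List.singleton_append, ← List.replicate_succ]
        exact .refl _
      · exact steps_replicate_a_b n
    have h := (hx.append_right p).trans (by
      simpa using (ih fun y hy => hp y (by simp [hy])).append_left [x])
    simpa using h

/-- Case 1(a): with `p = (ab)^j(ba)^j`, the word `u = a^i · baa · p · b` satisfies
`u ⇒* b · a^{i+2} · p · b`, this rewrites by `→*` to `b · p · a^{i+2} · b`, which is its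
reversal; hence `u·ū` satisfies the crossing condition. -/
theorem subrosa_case1a (i j : ℕ) :
    FSteps (rep [L.a] i ++ [L.b, L.a, L.a] ++ (rep [L.a, L.b] j ++ rep [L.b, L.a] j) ++ [L.b])
        ([L.b] ++ rep [L.a] (i + 2) ++ (rep [L.a, L.b] j ++ rep [L.b, L.a] j) ++ [L.b]) ∧
    Steps ([L.b] ++ rep [L.a] (i + 2) ++ (rep [L.a, L.b] j ++ rep [L.b, L.a] j) ++ [L.b])
        ([L.b] ++ (rep [L.a, L.b] j ++ rep [L.b, L.a] j) ++ rep [L.a] (i + 2) ++ [L.b]) ∧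
    [L.b] ++ (rep [L.a, L.b] j ++ rep [L.b, L.a] j) ++ rep [L.a] (i + 2) ++ [L.b] =
      ([L.b] ++ rep [L.a] (i + 2) ++ (rep [L.a, L.b] j ++ rep [L.b, L.a] j) ++ [L.b]).reverse ∧
    GoodWord ((rep [L.a] i ++ [L.b, L.a, L.a] ++ (rep [L.a, L.b] j ++ rep [L.b, L.a] j) ++ [L.b])
      ++ barw (rep [L.a] i ++ [L.b, L.a, L.a] ++ (rep [L.a, L.b] j ++ rep [L.b, L.a] j) ++ [L.b])) := by
  have hu : Steps (rep [L.a] i ++ [L.b, L.a, L.a] ++ (rep [L.a, L.b] j ++ rep [L.b, L.a] j) ++ [L.b])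
      ([L.b] ++ rep [L.a] (i + 2) ++ (rep [L.a, L.b] j ++ rep [L.b, L.a] j) ++ [L.b]) := by
    have h := (steps_replicate_a_b i).append_right
      ([L.a, L.a] ++ (rep [L.a, L.b] j ++ rep [L.b, L.a] j) ++ [L.b])
    simpa [rep_singleton, List.replicate_add] using h
  have hv : Steps ([L.b] ++ rep [L.a] (i + 2) ++ (rep [L.a, L.b] j ++ rep [L.b, L.a] j) ++ [L.b])
      ([L.b] ++ (rep [L.a, L.b] j ++ rep [L.b, L.a] j) ++ rep [L.a] (i + 2) ++ [L.b]) := by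
    have hp : ∀ x ∈ rep [L.a, L.b] j ++ rep [L.b, L.a] j, x = L.a ∨ x = L.b := by
      intro x hx
      rcases List.mem_append.1 hx with hx | hx
      · simpa using mem_of_mem_rep hx
      · simpa [or_comm] using mem_of_mem_rep hx
    have h := ((steps_replicate_a_append (i + 2) _ hp).append_left [L.b]).append_right [L.b]
    simpa only [rep_singleton, List.append_assoc] using h
  have hrev : [L.b] ++ (rep [L.a, L.b] j ++ rep [L.b, L.a] j) ++ rep [L.a] (i + 2) ++ [L.b] =
      ([L.b] ++ rep [L.a] (i + 2) ++ (rep [L.a, L.b] j ++ rep [L.b, L.a] j) ++ [L.b]).reverse := by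
    simp [reverse_rep]
  exact ⟨hu.fSteps, hv, hrev, goodWord_append_barw hu (hrev ▸ hv)⟩
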